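/- arXiv:1211.7325 — 2 statements merged into one kernel-verified Lean document; each statement's English description precedes it below -/
import Mathlib

section
/- For all real ν ≥ 1/2, all real γ with 0 ≤ γ < 1, every natural number n, and all x > 0, the repeated integrals satisfy I_{(ν,-γ,n)}(x) ≤ (1-γ)^{-n} e^{-γx} I_{(ν,0,n)}(x). -/
open Real MeasureTheory

/-- The modified Bessel function of the first kind
`I_ν(x) = Σ_{k=0}^∞ (1/(k! Γ(k+ν+1))) (x/2)^{2k+ν}`. -/
noncomputable def besselI (ν x : ℝ) : ℝ :=
  ∑' k : ℕ, (1 / ((k.factorial : ℝ) * Real.Gamma ((k : ℝ) + ν + 1))) *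
    (x / 2) ^ (2 * (k : ℝ) + ν)

/-- The repeated integrals `I_{(ν,β,0)}(x) = e^{βx} x^ν I_ν(x)`,
`I_{(ν,β,n+1)}(x) = ∫_0^x I_{(ν,β,n)}(y) dy`. -/
noncomputable def besselIRep (ν β : ℝ) : ℕ → ℝ → ℝ
  | 0 => fun x => Real.exp (β * x) * x ^ ν * besselI ν x
  | n + 1 => fun x => ∫ y in (0 : ℝ)..x, besselIRep ν β n y

/-- The coefficient of `x ^ (2 k + 2 ν)` in `x ^ ν I_ν(x)`. -/
noncomputable def besselCoeff (ν : ℝ) (k : ℕ) : ℝ :=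
  1 / ((k.factorial : ℝ) * Real.Gamma ((k : ℝ) + ν + 1)) * (1 / 2) ^ (2 * (k : ℝ) + ν)

theorem besselCoeff_pos {ν : ℝ} (hν : 1 / 2 ≤ ν) (k : ℕ) : 0 < besselCoeff ν k := by
  have : 0 < Real.Gamma ((k : ℝ) + ν + 1) := Real.Gamma_pos_of_pos (by positivity)
  unfold besselCoeff
  positivity

theorem besselCoeff_succ {ν : ℝ} (hν : 1 / 2 ≤ ν) (k : ℕ) :
    besselCoeff ν (k + 1) * (4 * (k + 1) * (k + ν + 1)) = besselCoeff ν k := by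
  have hk : (0 : ℝ) < k + ν + 1 := by positivity
  have hG : 0 < Real.Gamma ((k : ℝ) + ν + 1) := Real.Gamma_pos_of_pos hk
  have h1 : Real.Gamma (((k + 1 : ℕ) : ℝ) + ν + 1)
      = (k + ν + 1) * Real.Gamma ((k : ℝ) + ν + 1) := by
    rw [← Real.Gamma_add_one hk.ne']
    congr 1
    push_cast
    ring
  have h2 : ((1 : ℝ) / 2) ^ (2 * ((k + 1 : ℕ) : ℝ) + ν)
      = (1 / 2) ^ (2 * (k : ℝ) + ν) * (1 / 4) := by
    have : 2 * ((k + 1 : ℕ) : ℝ) + ν = (2 * (k : ℝ) + ν) + 2 := by push_cast; ring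
    rw [this, Real.rpow_add (by norm_num)]
    norm_num
  unfold besselCoeff
  rw [h1, h2, Nat.factorial_succ]
  push_cast
  field_simp

theorem besselCoeff_le {ν : ℝ} (hν : 1 / 2 ≤ ν) (k : ℕ) :
    besselCoeff ν k ≤ besselCoeff ν 0 / k.factorial := by
  induction k with
  | zero => simp
  | succ k ih =>
    have hpos := besselCoeff_pos hν (k + 1)
    have hk : (0 : ℝ) ≤ k := k.cast_nonneg
    rw [← besselCoeff_succ hν k, le_div_iff₀ (by positivity)] at ih
    rw [Nat.factorial_succ, le_div_iff₀ (by positivity)]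
    push_cast
    refine le_trans ?_ ih
    have : besselCoeff ν (k + 1) * ((k + 1) * 1 * k.factorial)
        ≤ besselCoeff ν (k + 1) * ((k + 1) * (4 * (k + ν + 1)) * k.factorial) := by
      gcongr
      linarith
    linarith

theorem summable_besselCoeff_mul_rpow {ν : ℝ} (hν : 1 / 2 ≤ ν) {x : ℝ} (hx : 0 ≤ x) :
    Summable fun k : ℕ => besselCoeff ν k * x ^ (2 * (k : ℝ) + 2 * ν) := by
  have hs := (Real.summable_pow_div_factorial (x ^ 2)).mul_left (besselCoeff ν 0 * x ^ (2 * ν))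
  refine hs.of_nonneg_of_le (fun k => ?_) (fun k => ?_)
  · have := besselCoeff_pos hν k
    positivity
  · have h : x ^ (2 * (k : ℝ) + 2 * ν) = (x ^ 2) ^ k * x ^ (2 * ν) := by
      rw [Real.rpow_add_of_nonneg hx (by positivity) (by positivity), ← pow_mul,
        ← Real.rpow_natCast]
      push_cast
      rfl
    rw [h]
    calc _ ≤ besselCoeff ν 0 / k.factorial * ((x ^ 2) ^ k * x ^ (2 * ν)) := by
          gcongr
          exact besselCoeff_le hν k
      _ = _ := by ring

theorem besselIRep_zero_zero_eq_tsum {ν : ℝ} (hν : 1 / 2 ≤ ν) {x : ℝ} (hx : 0 ≤ x) :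
    besselIRep ν 0 0 x = ∑' k : ℕ, besselCoeff ν k * x ^ (2 * (k : ℝ) + 2 * ν) := by
  simp only [besselIRep, besselI, zero_mul, Real.exp_zero, one_mul, ← tsum_mul_left]
  congr 1 with k
  have h1 : x ^ (2 * (k : ℝ) + 2 * ν) = x ^ (2 * (k : ℝ) + ν) * x ^ ν := by
    rw [← Real.rpow_add_of_nonneg hx (by positivity) (by positivity)]
    congr 1
    ring
  have h2 : (x / 2) ^ (2 * (k : ℝ) + ν)
      = x ^ (2 * (k : ℝ) + ν) * (1 / 2) ^ (2 * (k : ℝ) + ν) := by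
    rw [← Real.mul_rpow hx (by norm_num)]
    congr 1
    ring
  rw [h1, h2, besselCoeff]
  ring

theorem hasSum_besselIRep_zero_zero {ν : ℝ} (hν : 1 / 2 ≤ ν) {x : ℝ} (hx : 0 ≤ x) :
    HasSum (fun k : ℕ => besselCoeff ν k * x ^ (2 * (k : ℝ) + 2 * ν)) (besselIRep ν 0 0 x) := by
  rw [besselIRep_zero_zero_eq_tsum hν hx]
  exact (summable_besselCoeff_mul_rpow hν hx).hasSum

theorem besselIRep_zero_eq_exp_mul (ν β x : ℝ) :
    besselIRep ν β 0 x = Real.exp (β * x) * besselIRep ν 0 0 x := by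
  simp [besselIRep, mul_assoc]

theorem continuousOn_besselIRep_zero_zero {ν : ℝ} (hν : 1 / 2 ≤ ν) (R : ℝ) :
    ContinuousOn (besselIRep ν 0 0) (Set.Icc 0 R) := by
  rcases lt_or_ge R 0 with hR | hR
  · simp [Set.Icc_eq_empty (not_le.2 hR)]
  have h : ContinuousOn (fun x : ℝ => ∑' k : ℕ, besselCoeff ν k * x ^ (2 * (k : ℝ) + 2 * ν))
      (Set.Icc 0 R) := by
    refine continuousOn_tsum (fun k => ?_) (summable_besselCoeff_mul_rpow hν hR) ?_
    · exact (continuous_const.mul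
        (Real.continuous_rpow_const (by positivity))).continuousOn
    · intro k x hx
      have hc := besselCoeff_pos hν k
      have h0 := hx.1
      rw [Real.norm_of_nonneg (by positivity)]
      gcongr
      exact hx.2
  exact h.congr fun x hx => besselIRep_zero_zero_eq_tsum hν hx.1

theorem continuousOn_besselIRep {ν : ℝ} (hν : 1 / 2 ≤ ν) (β : ℝ) (n : ℕ) {R : ℝ} (hR : 0 ≤ R) :
    ContinuousOn (besselIRep ν β n) (Set.Icc 0 R) := by
  induction n with
  | zero =>
    have h : ContinuousOn (fun x => Real.exp (β * x) * besselIRep ν 0 0 x) (Set.Icc 0 R) :=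
      ContinuousOn.mul (by fun_prop) (continuousOn_besselIRep_zero_zero hν R)
    exact h.congr fun x _ => besselIRep_zero_eq_exp_mul ν β x
  | succ n ih =>
    have h := intervalIntegral.continuousOn_primitive_interval (μ := volume)
      (a := 0) (b := R) (f := besselIRep ν β n)
      (by rw [Set.uIcc_of_le hR]; exact ih.integrableOn_Icc)
    rwa [Set.uIcc_of_le hR] at h

theorem intervalIntegrable_besselIRep {ν : ℝ} (hν : 1 / 2 ≤ ν) (β : ℝ) (n : ℕ) {R : ℝ}
    (hR : 0 ≤ R) : IntervalIntegrable (besselIRep ν β n) volume 0 R :=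
  (continuousOn_besselIRep hν β n hR).intervalIntegrable_of_Icc hR

/-- The partial sums `T_N` of `x ^ ν I_ν(x)` satisfy `∫ T_N ≤ T_{N+1}`. -/
theorem integral_partialSum_le {ν : ℝ} (hν : 1 / 2 ≤ ν) (N : ℕ) {x : ℝ} (hx : 0 ≤ x) :
    ∫ y in (0 : ℝ)..x, ∑ k ∈ Finset.range N, besselCoeff ν k * y ^ (2 * (k : ℝ) + 2 * ν)
      ≤ ∑ k ∈ Finset.range (N + 1), besselCoeff ν k * x ^ (2 * (k : ℝ) + 2 * ν) := by
  set T : ℕ → ℝ → ℝ := fun N y =>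
    ∑ k ∈ Finset.range N, besselCoeff ν k * y ^ (2 * (k : ℝ) + 2 * ν) with hT
  set G : ℝ → ℝ := fun x => ∫ y in (0 : ℝ)..x, T N y with hG
  set T' : ℝ → ℝ := fun y => ∑ k ∈ Finset.range (N + 1),
    besselCoeff ν k * ((2 * (k : ℝ) + 2 * ν) * y ^ (2 * (k : ℝ) + 2 * ν - 1)) with hT'
  have hTc : ∀ M, Continuous (T M) := fun M => continuous_finsetSum _ fun k _ =>
    continuous_const.mul (Real.continuous_rpow_const (by positivity))
  have hTd : ∀ y, HasDerivAt (T (N + 1)) (T' y) y := fun y =>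
    HasDerivAt.fun_sum fun k _ => (Real.hasDerivAt_rpow_const
      (Or.inr (by have : (0 : ℝ) ≤ k := k.cast_nonneg
                  linarith))).const_mul _
  have hGd : ∀ y, HasDerivAt G (T N y) y := fun y => (hTc N).integral_hasStrictDerivAt 0 y
    |>.hasDerivAt
  have hG_eq : ∀ y, G y = ∑ k ∈ Finset.range N, besselCoeff ν k *
      (y ^ (2 * (k : ℝ) + 2 * ν + 1) / (2 * (k : ℝ) + 2 * ν + 1)) := by
    intro y
    simp only [hG, hT]
    rw [intervalIntegral.integral_finsetSum]
    · refine Finset.sum_congr rfl fun k _ => ?_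
      have h0 : (0 : ℝ) < 2 * (k : ℝ) + 2 * ν + 1 := by positivity
      rw [intervalIntegral.integral_const_mul, integral_rpow (Or.inl (by linarith)),
        Real.zero_rpow h0.ne', sub_zero]
    · intro k _
      exact (continuous_const.mul
        (Real.continuous_rpow_const (by positivity))).intervalIntegrable _ _
  have hT'G : ∀ y, 0 ≤ y → G y ≤ T' y := by
    intro y hy
    rw [hG_eq, hT']
    simp only
    rw [Finset.sum_range_succ']
    have h0 : 0 ≤ besselCoeff ν 0 * ((2 * ((0 : ℕ) : ℝ) + 2 * ν) *
        y ^ (2 * ((0 : ℕ) : ℝ) + 2 * ν - 1)) := by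
      have := besselCoeff_pos hν 0
      positivity
    refine le_add_of_le_of_nonneg (Finset.sum_le_sum fun k _ => ?_) h0
    have hc := besselCoeff_pos hν (k + 1)
    have hk : (0 : ℝ) ≤ k := k.cast_nonneg
    have he : 2 * ((k + 1 : ℕ) : ℝ) + 2 * ν - 1 = 2 * (k : ℝ) + 2 * ν + 1 := by
      push_cast
      ring
    rw [he, ← besselCoeff_succ hν k]
    have hp : (0 : ℝ) < 2 * (k : ℝ) + 2 * ν + 1 := by positivity
    have hcoef : 4 * (k + 1) * (k + ν + 1) / (2 * (k : ℝ) + 2 * ν + 1)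
        ≤ 2 * ((k + 1 : ℕ) : ℝ) + 2 * ν := by
      rw [div_le_iff₀ hp]
      push_cast
      nlinarith [mul_nonneg (by linarith : (0 : ℝ) ≤ 2 * ν - 1)
        (by linarith : (0 : ℝ) ≤ k + ν + 1)]
    calc _ = besselCoeff ν (k + 1) * (4 * (k + 1) * (k + ν + 1) / (2 * (k : ℝ) + 2 * ν + 1)
          * y ^ (2 * (k : ℝ) + 2 * ν + 1)) := by ring
      _ ≤ _ := by gcongr
  have hTT : ∀ y, 0 ≤ y → T N y ≤ T (N + 1) y := by
    intro y hy
    have := besselCoeff_pos hν N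
    simp only [hT, Finset.sum_range_succ]
    exact le_add_of_nonneg_right (by positivity)
  have hφ : ∀ y, HasDerivAt (fun y => Real.exp y * (T (N + 1) y - G y))
      (Real.exp y * (T (N + 1) y - G y) + Real.exp y * (T' y - T N y)) y := fun y =>
    (Real.hasDerivAt_exp y).mul ((hTd y).sub (hGd y))
  have hmono : MonotoneOn (fun y => Real.exp y * (T (N + 1) y - G y)) (Set.Ici 0) := by
    refine monotoneOn_of_deriv_nonneg (convex_Ici 0)
      (fun y _ => (hφ y).continuousAt.continuousWithinAt)
      (fun y _ => (hφ y).differentiableAt.differentiableWithinAt) fun y hy => ?_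
    rw [interior_Ici] at hy
    rw [(hφ y).deriv, ← mul_add]
    have h1 := hT'G y (le_of_lt hy)
    have h2 := hTT y (le_of_lt hy)
    exact mul_nonneg (Real.exp_pos y).le (by linarith)
  have h := hmono (Set.self_mem_Ici) (Set.mem_Ici.2 hx) hx
  have hT0 : 0 ≤ T (N + 1) 0 := Finset.sum_nonneg fun k _ => by
    have := besselCoeff_pos hν k
    positivity
  have hG0 : G 0 = 0 := intervalIntegral.integral_same
  simp only [hG0, Real.exp_zero, one_mul, sub_zero] at h
  have := nonneg_of_mul_nonneg_right (hT0.trans h) (Real.exp_pos x)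
  exact sub_nonneg.1 this

theorem besselIRep_zero_one_le {ν : ℝ} (hν : 1 / 2 ≤ ν) {x : ℝ} (hx : 0 ≤ x) :
    besselIRep ν 0 1 x ≤ besselIRep ν 0 0 x := by
  have hnn : ∀ y : ℝ, 0 ≤ y → ∀ k : ℕ, 0 ≤ besselCoeff ν k * y ^ (2 * (k : ℝ) + 2 * ν) := by
    intro y hy k
    have := besselCoeff_pos hν k
    positivity
  have hlim : Filter.Tendsto (fun N : ℕ => ∫ y in (0 : ℝ)..x,
      ∑ k ∈ Finset.range N, besselCoeff ν k * y ^ (2 * (k : ℝ) + 2 * ν))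
      Filter.atTop (nhds (∫ y in (0 : ℝ)..x, besselIRep ν 0 0 y)) := by
    refine intervalIntegral.tendsto_integral_filter_of_dominated_convergence
      (besselIRep ν 0 0) (Filter.Eventually.of_forall fun N => ?_)
      (Filter.Eventually.of_forall fun N => Filter.Eventually.of_forall fun y hy => ?_)
      (intervalIntegrable_besselIRep hν 0 0 hx) (Filter.Eventually.of_forall fun y hy => ?_)
    · exact (continuous_finsetSum _ fun k _ => continuous_const.mul
        (Real.continuous_rpow_const (by positivity))).aestronglyMeasurable
    · rw [Set.uIoc_of_le hx] at hy
      rw [Real.norm_of_nonneg (Finset.sum_nonneg fun k _ => hnn y hy.1.le k)]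
      exact sum_le_hasSum _ (fun k _ => hnn y hy.1.le k)
        (hasSum_besselIRep_zero_zero hν hy.1.le)
    · rw [Set.uIoc_of_le hx] at hy
      exact (hasSum_besselIRep_zero_zero hν hy.1.le).tendsto_sum_nat
  exact le_of_tendsto' hlim fun N => (integral_partialSum_le hν N hx).trans
    (sum_le_hasSum _ (fun k _ => hnn x hx k) (hasSum_besselIRep_zero_zero hν hx))

theorem besselIRep_zero_succ_le {ν : ℝ} (hν : 1 / 2 ≤ ν) (n : ℕ) {x : ℝ} (hx : 0 ≤ x) :
    besselIRep ν 0 (n + 1) x ≤ besselIRep ν 0 n x := by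
  induction n generalizing x with
  | zero => exact besselIRep_zero_one_le hν hx
  | succ n ih =>
    exact intervalIntegral.integral_mono_on hx (intervalIntegrable_besselIRep hν 0 (n + 1) hx)
      (intervalIntegrable_besselIRep hν 0 n hx) fun y hy => ih hy.1

/-- If `f` dominates its own primitive, then inserting `e ^ (-γ y)` in the integral costs at most
the factor `1 / (1 - γ)`. -/
theorem integral_exp_mul_le_of_integral_le {f : ℝ → ℝ} {γ x : ℝ} (hγ0 : 0 ≤ γ) (hγ1 : γ < 1)
    (hx : 0 ≤ x) (hf : ContinuousOn f (Set.Icc 0 x))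
    (hle : ∀ y ∈ Set.Icc 0 x, ∫ t in (0 : ℝ)..y, f t ≤ f y) :
    ∫ y in (0 : ℝ)..x, Real.exp (-γ * y) * f y
      ≤ 1 / (1 - γ) * Real.exp (-γ * x) * ∫ y in (0 : ℝ)..x, f y := by
  have hpos : 0 < 1 - γ := by linarith
  have hprim : ∀ g : ℝ → ℝ, ContinuousOn g (Set.Icc 0 x) →
      ContinuousOn (fun y => ∫ t in (0 : ℝ)..y, g t) (Set.Icc 0 x) ∧
      ∀ y ∈ Set.Ioo 0 x, HasDerivAt (fun y => ∫ t in (0 : ℝ)..y, g t) (g y) y := by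
    intro g hg
    constructor
    · have h := intervalIntegral.continuousOn_primitive_interval (μ := volume)
        (a := 0) (b := x) (f := g) (by rw [Set.uIcc_of_le hx]; exact hg.integrableOn_Icc)
      rwa [Set.uIcc_of_le hx] at h
    · intro y hy
      refine intervalIntegral.integral_hasDerivAt_right
        ((hg.mono (Set.Icc_subset_Icc_right hy.2.le)).intervalIntegrable_of_Icc hy.1.le) ?_
        (hg.continuousAt (Icc_mem_nhds hy.1 hy.2))
      exact (hg.mono Set.Ioo_subset_Icc_self).stronglyMeasurableAtFilter isOpen_Ioo y hy
  obtain ⟨hFc, hFd⟩ := hprim f hf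
  obtain ⟨hEc, hEd⟩ := hprim (fun y => Real.exp (-γ * y) * f y)
    (ContinuousOn.mul (by fun_prop) hf)
  set F : ℝ → ℝ := fun y => ∫ t in (0 : ℝ)..y, f t with hF
  set E : ℝ → ℝ := fun y => ∫ t in (0 : ℝ)..y, Real.exp (-γ * t) * f t with hE
  have hexp : ∀ y, HasDerivAt (fun y => 1 / (1 - γ) * Real.exp (-γ * y))
      (1 / (1 - γ) * (Real.exp (-γ * y) * (-γ))) y := fun y => by
    have h := ((hasDerivAt_id y).const_mul (-γ)).exp.const_mul (1 / (1 - γ))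
    simpa using h
  have hD : ∀ y ∈ Set.Ioo 0 x, HasDerivAt (fun y => 1 / (1 - γ) * Real.exp (-γ * y) * F y - E y)
      (γ / (1 - γ) * Real.exp (-γ * y) * (f y - F y)) y := by
    intro y hy
    refine (((hexp y).mul (hFd y hy)).sub (hEd y hy)).congr_deriv ?_
    field_simp
    ring
  have hmono : MonotoneOn (fun y => 1 / (1 - γ) * Real.exp (-γ * y) * F y - E y)
      (Set.Icc 0 x) := by
    refine monotoneOn_of_deriv_nonneg (convex_Icc 0 x)
      ((ContinuousOn.mul (by fun_prop) hFc).sub hEc) ?_ ?_ <;> rw [interior_Icc]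
    · exact fun y hy => (hD y hy).differentiableAt.differentiableWithinAt
    · intro y hy
      rw [(hD y hy).deriv]
      have := sub_nonneg.2 (hle y (Set.Ioo_subset_Icc_self hy))
      exact mul_nonneg (by positivity) this
  have h := hmono (Set.left_mem_Icc.2 hx) (Set.right_mem_Icc.2 hx) hx
  simp only [hF, hE, intervalIntegral.integral_same, mul_zero, sub_zero] at h
  exact sub_nonneg.1 h

theorem besselIRep_neg_le_of_nonneg {ν γ : ℝ} (hν : 1 / 2 ≤ ν) (hγ0 : 0 ≤ γ) (hγ1 : γ < 1)
    (n : ℕ) {x : ℝ} (hx : 0 ≤ x) :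
    besselIRep ν (-γ) n x ≤ (1 / (1 - γ) ^ n) * Real.exp (-γ * x) * besselIRep ν 0 n x := by
  have hpos : 0 < 1 - γ := by linarith
  induction n generalizing x with
  | zero => rw [besselIRep_zero_eq_exp_mul, pow_zero, div_one, one_mul]
  | succ n ih =>
    have hf := continuousOn_besselIRep hν 0 n hx
    have hint : IntervalIntegrable (fun y => 1 / (1 - γ) ^ n *
        (Real.exp (-γ * y) * besselIRep ν 0 n y)) volume 0 x :=
      (ContinuousOn.mul (by fun_prop) (ContinuousOn.mul (by fun_prop) hf)).intervalIntegrable_of_Icc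
        hx
    calc besselIRep ν (-γ) (n + 1) x
        ≤ ∫ y in (0 : ℝ)..x, 1 / (1 - γ) ^ n * (Real.exp (-γ * y) * besselIRep ν 0 n y) :=
          intervalIntegral.integral_mono_on hx (intervalIntegrable_besselIRep hν (-γ) n hx) hint
            fun y hy => (ih hy.1).trans_eq (mul_assoc _ _ _)
      _ = 1 / (1 - γ) ^ n * ∫ y in (0 : ℝ)..x, Real.exp (-γ * y) * besselIRep ν 0 n y :=
          intervalIntegral.integral_const_mul _ _
      _ ≤ 1 / (1 - γ) ^ n * (1 / (1 - γ) * Real.exp (-γ * x) * besselIRep ν 0 (n + 1) x) := by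
          gcongr
          exact integral_exp_mul_le_of_integral_le hγ0 hγ1 hx hf
            fun y hy => besselIRep_zero_succ_le hν n hy.1
      _ = _ := by
          rw [pow_succ]
          field_simp

theorem besselIRep_neg_gamma_le (ν γ : ℝ) (hν : 1 / 2 ≤ ν) (hγ0 : 0 ≤ γ) (hγ1 : γ < 1)
    (n : ℕ) (x : ℝ) (hx : 0 < x) :
    besselIRep ν (-γ) n x ≤ (1 / (1 - γ) ^ n) * Real.exp (-γ * x) * besselIRep ν 0 n x :=
  besselIRep_neg_le_of_nonneg hν hγ0 hγ1 n hx.le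
end

section
/- For all real ν < 1/2 and all x > 0, ∫_x^∞ t^ν K_ν(t) dt < x^ν K_ν(x). -/
open Real MeasureTheory

/-- The modified Bessel function of the second kind
`K_ν(x) = ∫_0^∞ e^{-x cosh t} cosh(ν t) dt`. -/
noncomputable def besselK (ν x : ℝ) : ℝ :=
  ∫ t in Set.Ioi (0 : ℝ), Real.exp (-x * Real.cosh t) * Real.cosh (ν * t)

open Filter Topology

lemma sq_div_four_le_cosh {t : ℝ} (ht : 0 ≤ t) : t ^ 2 / 4 ≤ Real.cosh t := by
  have h1 := Real.quadratic_le_exp_of_nonneg ht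
  have h2 := Real.exp_pos (-t)
  rw [Real.cosh_eq]
  linarith

lemma exp_neg_mul_cosh_mul_exp_le {x : ℝ} (hx : 0 < x) (a : ℝ) {t : ℝ} (ht : 0 ≤ t) :
    Real.exp (-x * Real.cosh t) * Real.exp (a * t) ≤
      Real.exp (2 * a ^ 2 / x) * Real.exp (-(x / 8) * t ^ 2) := by
  rw [← Real.exp_add, ← Real.exp_add, Real.exp_le_exp]
  have h1 := mul_le_mul_of_nonneg_left (sq_div_four_le_cosh ht) hx.le
  have h2 : 2 * a ^ 2 / x + x * t ^ 2 / 8 - a * t = (4 * a - x * t) ^ 2 / (8 * x) := by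
    field_simp
    ring
  have h3 : 0 ≤ (4 * a - x * t) ^ 2 / (8 * x) := by positivity
  linarith

lemma integrableOn_of_abs_le_exp_neg_mul_cosh {x : ℝ} (hx : 0 < x) (a : ℝ) {f : ℝ → ℝ}
    (hf : Continuous f)
    (h : ∀ t, 0 ≤ t → |f t| ≤ Real.exp (-x * Real.cosh t) * Real.exp (a * t)) :
    IntegrableOn f (Set.Ioi 0) := by
  have hg : IntegrableOn
      (fun t : ℝ => Real.exp (2 * a ^ 2 / x) * Real.exp (-(x / 8) * t ^ 2)) (Set.Ioi 0) :=
    ((integrable_exp_neg_mul_sq (by positivity : 0 < x / 8)).const_mul _).integrableOn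
  refine hg.mono' hf.aestronglyMeasurable ?_
  filter_upwards [ae_restrict_mem measurableSet_Ioi] with t ht
  exact (h t (le_of_lt ht)).trans (exp_neg_mul_cosh_mul_exp_le hx a (le_of_lt ht))

lemma tendsto_zero_of_abs_le_exp_neg_mul_cosh {x : ℝ} (hx : 0 < x) (a : ℝ) {f : ℝ → ℝ}
    (h : ∀ t, 0 ≤ t → |f t| ≤ Real.exp (-x * Real.cosh t) * Real.exp (a * t)) :
    Tendsto f atTop (𝓝 0) := by
  have h1 : Tendsto (fun t : ℝ => Real.exp (-(x / 8) * t ^ 2)) atTop (𝓝 0) := by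
    refine Real.tendsto_exp_atBot.comp ?_
    exact (tendsto_pow_atTop two_ne_zero).const_mul_atTop_of_neg (by linarith)
  have h2 := h1.const_mul (Real.exp (2 * a ^ 2 / x))
  rw [mul_zero] at h2
  refine squeeze_zero_norm' ?_ h2
  filter_upwards [eventually_ge_atTop 0] with t ht
  exact (h t ht).trans (exp_neg_mul_cosh_mul_exp_le hx a ht)

lemma cosh_mul_le_exp (ν : ℝ) {t : ℝ} (ht : 0 ≤ t) :
    Real.cosh (ν * t) ≤ Real.exp (|ν| * t) := by
  rw [← Real.cosh_abs, abs_mul, abs_of_nonneg ht, Real.cosh_eq]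
  have : Real.exp (-(|ν| * t)) ≤ Real.exp (|ν| * t) :=
    Real.exp_le_exp.2 (by linarith [mul_nonneg (abs_nonneg ν) ht])
  linarith

lemma abs_sinh_le_cosh (t : ℝ) : |Real.sinh t| ≤ Real.cosh t := by
  rw [Real.abs_sinh, ← Real.cosh_abs t]
  exact (Real.sinh_lt_cosh _).le

lemma abs_exp_mul_le {x ν t : ℝ} (ht : 0 ≤ t) {u : ℝ} (hu : |u| ≤ Real.cosh (ν * t)) :
    |Real.exp (-x * Real.cosh t) * u| ≤
      Real.exp (-x * Real.cosh t) * Real.exp (|ν| * t) := by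
  rw [abs_mul, Real.abs_exp]
  gcongr
  exact hu.trans (cosh_mul_le_exp ν ht)

lemma abs_exp_mul_mul_le {x ν t : ℝ} (ht : 0 ≤ t) {u v : ℝ} (hu : |u| ≤ Real.cosh (ν * t))
    (hv : |v| ≤ Real.cosh t) :
    |Real.exp (-x * Real.cosh t) * u * v| ≤
      Real.exp (-x * Real.cosh t) * Real.exp ((|ν| + 1) * t) := by
  rw [abs_mul, add_mul, Real.exp_add, ← mul_assoc]
  have h := cosh_mul_le_exp 1 ht
  rw [one_mul, abs_one] at h
  exact mul_le_mul (abs_exp_mul_le ht hu) (hv.trans h) (abs_nonneg _) (by positivity)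

lemma integrableOn_besselK (ν : ℝ) {x : ℝ} (hx : 0 < x) :
    IntegrableOn (fun t => Real.exp (-x * Real.cosh t) * Real.cosh (ν * t)) (Set.Ioi 0) :=
  integrableOn_of_abs_le_exp_neg_mul_cosh hx |ν| (by fun_prop)
    fun _ ht => abs_exp_mul_le ht (abs_of_pos (Real.cosh_pos _)).le

lemma integrableOn_besselK_mul_cosh (ν : ℝ) {x : ℝ} (hx : 0 < x) :
    IntegrableOn (fun t => Real.exp (-x * Real.cosh t) * Real.cosh (ν * t) * Real.cosh t)
      (Set.Ioi 0) :=
  integrableOn_of_abs_le_exp_neg_mul_cosh hx (|ν| + 1) (by fun_prop)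
    fun _ ht => abs_exp_mul_mul_le ht (abs_of_pos (Real.cosh_pos _)).le (abs_of_pos (Real.cosh_pos _)).le

lemma integrableOn_besselK_mul_sinh (ν : ℝ) {x : ℝ} (hx : 0 < x) :
    IntegrableOn (fun t => Real.exp (-x * Real.cosh t) * Real.sinh (ν * t) * Real.sinh t)
      (Set.Ioi 0) :=
  integrableOn_of_abs_le_exp_neg_mul_cosh hx (|ν| + 1) (by fun_prop)
    fun _ ht => abs_exp_mul_mul_le ht (abs_sinh_le_cosh _) (abs_sinh_le_cosh _)

lemma mul_integral_sinh_mul_sinh (ν : ℝ) {x : ℝ} (hx : 0 < x) :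
    x * ∫ t in Set.Ioi (0 : ℝ), Real.exp (-x * Real.cosh t) * Real.sinh (ν * t) * Real.sinh t =
      ν * besselK ν x := by
  have hderiv : ∀ t ∈ Set.Ici (0 : ℝ),
      HasDerivAt (fun t => Real.exp (-x * Real.cosh t) * Real.sinh (ν * t))
        (ν * (Real.exp (-x * Real.cosh t) * Real.cosh (ν * t)) -
          x * (Real.exp (-x * Real.cosh t) * Real.sinh (ν * t) * Real.sinh t)) t := by
    intro t _
    have h1 := ((Real.hasDerivAt_cosh t).const_mul (-x)).exp
    have h2 := ((hasDerivAt_id t).const_mul ν).sinh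
    refine (h1.mul h2).congr_deriv ?_
    simp only [id]
    ring
  have hi1 := (integrableOn_besselK ν hx).const_mul ν
  have hi2 := (integrableOn_besselK_mul_sinh ν hx).const_mul x
  have h := integral_Ioi_of_hasDerivAt_of_tendsto' hderiv (hi1.sub hi2)
    (tendsto_zero_of_abs_le_exp_neg_mul_cosh hx |ν|
      fun _ ht => abs_exp_mul_le ht (abs_sinh_le_cosh _))
  rw [integral_sub hi1 hi2, integral_const_mul, integral_const_mul] at h
  simp only [mul_zero, Real.sinh_zero, sub_zero] at h
  rw [besselK]
  linarith

lemma besselK_sub_one (ν : ℝ) {x : ℝ} (hx : 0 < x) :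
    besselK (ν - 1) x =
      (∫ t in Set.Ioi (0 : ℝ), Real.exp (-x * Real.cosh t) * Real.cosh (ν * t) * Real.cosh t) -
        ν / x * besselK ν x := by
  have h := mul_integral_sinh_mul_sinh ν hx
  rw [div_mul_eq_mul_div, ← h, mul_div_cancel_left₀ _ hx.ne',
    ← integral_sub (integrableOn_besselK_mul_cosh ν hx) (integrableOn_besselK_mul_sinh ν hx),
    besselK]
  congr 1
  ext t
  rw [sub_mul, one_mul, Real.cosh_sub]
  ring

lemma hasDerivAt_besselK (ν : ℝ) {x : ℝ} (hx : 0 < x) :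
    HasDerivAt (besselK ν) (-besselK (ν - 1) x - ν / x * besselK ν x) x := by
  have h := hasDerivAt_integral_of_dominated_loc_of_deriv_le
    (μ := volume.restrict (Set.Ioi (0 : ℝ)))
    (F := fun y t => Real.exp (-y * Real.cosh t) * Real.cosh (ν * t))
    (F' := fun y t => -(Real.exp (-y * Real.cosh t) * Real.cosh (ν * t) * Real.cosh t))
    (bound := fun t => Real.exp (-(x / 2) * Real.cosh t) * Real.cosh (ν * t) * Real.cosh t)
    (Ioi_mem_nhds (half_lt_self hx))
    (Eventually.of_forall fun y => Continuous.aestronglyMeasurable (by fun_prop))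
    (integrableOn_besselK ν hx)
    (Continuous.aestronglyMeasurable (by fun_prop))
    (Eventually.of_forall fun t y hy => by
      have := Real.cosh_pos t
      have := Real.cosh_pos (ν * t)
      rw [norm_neg, Real.norm_of_nonneg (by positivity)]
      gcongr
      exact le_of_lt hy)
    (integrableOn_besselK_mul_cosh ν (half_pos hx))
    (Eventually.of_forall fun t y _ => by
      have h1 := (((hasDerivAt_id y).neg.mul_const (Real.cosh t)).exp).mul_const
        (Real.cosh (ν * t))
      refine h1.congr_deriv ?_
      simp only [id, Pi.neg_apply]
      ring)
  refine h.2.congr_deriv ?_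
  rw [integral_neg, besselK_sub_one ν hx]
  ring

lemma hasDerivAt_rpow_mul_besselK (ν : ℝ) {x : ℝ} (hx : 0 < x) :
    HasDerivAt (fun t => t ^ ν * besselK ν t) (-(x ^ ν * besselK (ν - 1) x)) x := by
  refine ((Real.hasDerivAt_rpow_const (p := ν) (Or.inl hx.ne')).mul
    (hasDerivAt_besselK ν hx)).congr_deriv ?_
  rw [Real.rpow_sub_one hx.ne']
  ring

lemma besselK_nonneg (ν x : ℝ) : 0 ≤ besselK ν x :=
  integral_nonneg fun _ => mul_nonneg (Real.exp_pos _).le (Real.cosh_pos _).le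

lemma setIntegral_Ioi_pos {f : ℝ → ℝ} {a : ℝ} (hf : IntegrableOn f (Set.Ioi a))
    (hpos : ∀ t ∈ Set.Ioi a, 0 < f t) : 0 < ∫ t in Set.Ioi a, f t := by
  rw [setIntegral_pos_iff_support_of_nonneg_ae
    ((ae_restrict_mem measurableSet_Ioi).mono fun t ht => (hpos t ht).le) hf,
    Set.inter_eq_right.2 fun t ht => Function.mem_support.2 (hpos t ht).ne']
  simp

lemma besselK_lt_besselK {μ ν : ℝ} (h : |ν| < |μ|) {x : ℝ} (hx : 0 < x) :
    besselK ν x < besselK μ x := by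
  have hlt : ∀ t ∈ Set.Ioi (0 : ℝ), 0 < Real.exp (-x * Real.cosh t) * Real.cosh (μ * t) -
      Real.exp (-x * Real.cosh t) * Real.cosh (ν * t) := by
    intro t ht
    rw [← mul_sub]
    refine mul_pos (Real.exp_pos _) (sub_pos.2 (Real.cosh_lt_cosh.2 ?_))
    rw [abs_mul, abs_mul]
    exact mul_lt_mul_of_pos_right h (abs_pos.2 (ne_of_gt ht))
  have hi := (integrableOn_besselK μ hx).sub (integrableOn_besselK ν hx)
  rw [← sub_pos, besselK, besselK,
    ← integral_sub (integrableOn_besselK μ hx) (integrableOn_besselK ν hx)]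
  exact setIntegral_Ioi_pos hi hlt

lemma besselK_le_exp_mul (ν : ℝ) {x : ℝ} (hx : 1 ≤ x) :
    besselK ν x ≤ Real.exp (1 - x) * besselK ν 1 := by
  rw [besselK, besselK, ← integral_const_mul]
  refine integral_mono (integrableOn_besselK ν (by linarith))
    ((integrableOn_besselK ν one_pos).const_mul _) fun t => ?_
  have := Real.cosh_pos (ν * t)
  have h := Real.one_le_cosh t
  simp only
  rw [← mul_assoc, ← Real.exp_add]
  gcongr
  nlinarith

lemma tendsto_rpow_mul_besselK_atTop (ν : ℝ) :
    Tendsto (fun t => t ^ ν * besselK ν t) atTop (𝓝 0) := by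
  have h := (tendsto_rpow_mul_exp_neg_mul_atTop_nhds_zero ν 1 one_pos).mul_const
    (Real.exp 1 * besselK ν 1)
  rw [zero_mul] at h
  refine squeeze_zero' ?_ ?_ h
  · filter_upwards [eventually_ge_atTop 0] with t ht
    exact mul_nonneg (Real.rpow_nonneg ht _) (besselK_nonneg _ _)
  · filter_upwards [eventually_ge_atTop 1] with t ht
    have h1 := mul_le_mul_of_nonneg_left (besselK_le_exp_mul ν ht)
      (Real.rpow_nonneg (zero_le_one.trans ht) ν)
    refine h1.trans (le_of_eq ?_)
    rw [sub_eq_add_neg, Real.exp_add, neg_one_mul]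
    ring

theorem integral_besselK_lt' (ν : ℝ) (hν : ν < 1 / 2) (x : ℝ) (hx : 0 < x) :
    (∫ t in Set.Ioi x, t ^ ν * besselK ν t) < x ^ ν * besselK ν x := by
  have hderiv : ∀ t ∈ Set.Ici x, HasDerivAt (fun t => t ^ ν * besselK ν t)
      (-(t ^ ν * besselK (ν - 1) t)) t :=
    fun t ht => hasDerivAt_rpow_mul_besselK ν (hx.trans_le ht)
  have hnonpos : ∀ t ∈ Set.Ioi x, -(t ^ ν * besselK (ν - 1) t) ≤ 0 := fun t ht =>
    neg_nonpos.2 (mul_nonneg (Real.rpow_nonneg (hx.trans ht).le _) (besselK_nonneg _ _))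
  have hint := (integrableOn_Ioi_deriv_of_nonpos' hderiv hnonpos
    (tendsto_rpow_mul_besselK_atTop ν)).neg
  have heq := integral_Ioi_of_hasDerivAt_of_nonpos' hderiv hnonpos
    (tendsto_rpow_mul_besselK_atTop ν)
  simp only [Pi.neg_def, neg_neg] at hint
  rw [integral_neg, zero_sub, neg_inj] at heq
  have habs : |ν| < |ν - 1| := sq_lt_sq.1 (by nlinarith)
  have hlt : ∀ t ∈ Set.Ioi x, t ^ ν * besselK ν t < t ^ ν * besselK (ν - 1) t := fun t ht =>
    mul_lt_mul_of_pos_left (besselK_lt_besselK habs (hx.trans ht))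
      (Real.rpow_pos_of_pos (hx.trans ht) _)
  have hcont : ContinuousOn (fun t => t ^ ν * besselK ν t) (Set.Ioi x) := fun t ht =>
    (hderiv t (Set.Ioi_subset_Ici_self ht)).continuousAt.continuousWithinAt
  have hint' : IntegrableOn (fun t => t ^ ν * besselK ν t) (Set.Ioi x) := by
    refine Integrable.mono' hint (hcont.aestronglyMeasurable measurableSet_Ioi) ?_
    filter_upwards [ae_restrict_mem measurableSet_Ioi] with t ht
    rw [Real.norm_of_nonneg
      (mul_nonneg (Real.rpow_nonneg (hx.trans ht).le _) (besselK_nonneg _ _))]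
    exact (hlt t ht).le
  rw [← heq, ← sub_pos, ← integral_sub hint hint']
  exact setIntegral_Ioi_pos (hint.sub hint') fun t ht => sub_pos.2 (hlt t ht)
end
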